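/- Fix θ ∈ ℝ and p ∈ [−1,1], and let F : ℝ × ℂ² → ℂ be continuous with compact support. Let Λ^p(F) be the bounded operator on L²(ℝ × ℂ²) given by (Λ^p(F)ξ)(x) = ∫_M F(y)·ξ(y^{−1_p} ·_p x) dy, and for ℓ ∈ ℂ² let π̃^p_ℓ(F) be the bounded integral operator on L²(ℝ) with kernel (s,t) ↦ F̂(s−t, t ⊙_p ℓ), where F̂(u,ℓ) := ∫_{ℂ²} F(u,c)·exp(2πi⟨c,ℓ⟩) dc. Then ‖Λ^p(F)‖_op ≤ sup_{ℓ∈ℂ²} ‖π̃^p_ℓ(F)‖_op. -/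

import Mathlib

noncomputable section

open MeasureTheory

/-- The multiplication of the variable Mautner group `M_p`. -/
def vmul (θ p : ℝ) (x y : ℝ × ℂ × ℂ) : ℝ × ℂ × ℂ :=
  (x.1 + y.1,
   Complex.exp (((p : ℂ) + Complex.I) * (y.1 : ℂ)) * x.2.1 + y.2.1,
   Complex.exp ((-(p : ℂ) + Complex.I * (θ : ℂ)) * (y.1 : ℂ)) * x.2.2 + y.2.2)

/-- The inverse in the variable Mautner group `M_p`. -/
def vinv (θ p : ℝ) (x : ℝ × ℂ × ℂ) : ℝ × ℂ × ℂ :=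
  (-x.1,
   -(Complex.exp (-((p : ℂ) + Complex.I) * (x.1 : ℂ)) * x.2.1),
   -(Complex.exp (-(-(p : ℂ) + Complex.I * (θ : ℂ)) * (x.1 : ℂ)) * x.2.2))

/-- The dual action `r ⊙_p ℓ` of `ℝ` on `ℂ²`. -/
def dact (θ p : ℝ) (r : ℝ) (ℓ : ℂ × ℂ) : ℂ × ℂ :=
  (Complex.exp (((p : ℂ) - Complex.I) * (r : ℂ)) * ℓ.1,
   Complex.exp ((-(p : ℂ) - Complex.I * (θ : ℂ)) * (r : ℂ)) * ℓ.2)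

/-- The real pairing `⟨c,ℓ⟩ = Re(c₁ conj ℓ₁) + Re(c₂ conj ℓ₂)` on `ℂ²`. -/
def cpair (c ℓ : ℂ × ℂ) : ℝ :=
  (c.1 * (starRingEnd ℂ) ℓ.1).re + (c.2 * (starRingEnd ℂ) ℓ.2).re

/-- The `2π`-normalized partial Fourier transform
`F̂(u,ℓ) = ∫_{ℂ²} F(u,c) e^{2πi⟨c,ℓ⟩} dc`. -/
def pft2 (F : ℝ × ℂ × ℂ → ℂ) (u : ℝ) (ℓ : ℂ × ℂ) : ℂ :=
  ∫ c : ℂ × ℂ,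
    F (u, c) * Complex.exp (((2 * Real.pi : ℝ) : ℂ) * Complex.I * ((cpair c ℓ : ℝ) : ℂ))


open FourierTransform SchwartzMap in
/-- **Plancherel's theorem** for the Fourier integral of functions in `L¹ ∩ L²`. -/
theorem eLpNorm_fourier_eq {E : Type*} [NormedAddCommGroup E] [MeasurableSpace E] [BorelSpace E]
    [InnerProductSpace ℝ E] [FiniteDimensional ℝ E] {f : E → ℂ}
    (hf1 : Integrable f) (hf2 : MemLp f 2) :
    eLpNorm (𝓕 f) 2 volume = eLpNorm f 2 volume := by
  set g : Lp ℂ 2 (volume : Measure E) := hf2.toLp f with hg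
  have hcont : Continuous (𝓕 f) :=
    VectorFourier.fourierIntegral_continuous Real.continuous_fourierChar
      (innerSL ℝ).continuous₂ hf1
  have key : ∀ᵐ x, 𝓕 f x = (𝓕 g : Lp ℂ 2 (volume : Measure E)) x := by
    refine ae_eq_of_integral_contDiff_smul_eq hcont.locallyIntegrable
      ((Lp.memLp (𝓕 g)).locallyIntegrable (by norm_num)) fun φ hφ hφc => ?_
    let ψ : 𝓢(E, ℂ) := HasCompactSupport.toSchwartzMap (f := fun x => (φ x : ℂ))
      (hφc.comp_left (g := fun r : ℝ => (r : ℂ)) (by simp))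
      (Complex.ofRealCLM.contDiff.comp hφ)
    have h1 := congrArg (fun T => T ψ) (Lp.fourier_toTemperedDistribution_eq g)
    simp only [TemperedDistribution.fourier_apply, Lp.toTemperedDistribution_apply] at h1
    have h2 : ∫ x, (𝓕 ψ) x • g x = ∫ x, (𝓕 ψ) x • f x := by
      refine integral_congr_ae ?_
      filter_upwards [hf2.coeFn_toLp] with x hx
      rw [hg, hx]
    have h3 : ∫ x, (𝓕 (ψ : E → ℂ)) x • f x = ∫ x, ψ x • (𝓕 f) x := by
      have := VectorFourier.integral_fourierIntegral_smul_eq_flip (L := innerₗ E)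
        (μ := (volume : Measure E)) (ν := (volume : Measure E))
        Real.continuous_fourierChar continuous_inner ψ.integrable hf1
      rw [flip_innerₗ] at this
      exact this
    rw [h2, SchwartzMap.fourier_coe, h3] at h1
    exact h1
  rw [eLpNorm_congr_ae key, ← eLpNorm_congr_ae hf2.coeFn_toLp]
  have := Lp.norm_fourier_eq g
  rw [Lp.norm_def, Lp.norm_def] at this
  exact (ENNReal.toReal_eq_toReal_iff' (Lp.eLpNorm_ne_top _) (Lp.eLpNorm_ne_top _)).1 this

open FourierTransform in
theorem integral_mul_exp_cpair_eq_fourier (f : ℂ × ℂ → ℂ) (ℓ : ℂ × ℂ) :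
    ∫ c : ℂ × ℂ,
        f c * Complex.exp (((2 * Real.pi : ℝ) : ℂ) * Complex.I * ((cpair c ℓ : ℝ) : ℂ)) =
      𝓕 (fun v : WithLp 2 (ℂ × ℂ) => f (WithLp.ofLp v)) (WithLp.toLp 2 (-ℓ)) := by
  rw [Real.fourier_eq', ← (WithLp.volume_preserving_ofLp ℂ ℂ).integral_comp
    (MeasurableEquiv.toLp 2 (ℂ × ℂ)).symm.measurableEmbedding]
  refine integral_congr_ae (.of_forall fun v => ?_)
  simp only [smul_eq_mul]
  rw [mul_comm]
  congr 2
  simp [cpair, WithLp.prod_inner_apply, Complex.inner, mul_comm]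
  ring

/-- Plancherel's theorem for the pairing `cpair` on `ℂ²`. -/
theorem lintegral_enorm_sq_integral_mul_exp_cpair {f : ℂ × ℂ → ℂ} (hf : Continuous f)
    (hfs : HasCompactSupport f) :
    ∫⁻ ℓ : ℂ × ℂ, ‖∫ c : ℂ × ℂ,
        f c * Complex.exp (((2 * Real.pi : ℝ) : ℂ) * Complex.I * ((cpair c ℓ : ℝ) : ℂ))‖ₑ ^ 2 =
      ∫⁻ c : ℂ × ℂ, ‖f c‖ₑ ^ 2 := by
  have hmp := WithLp.volume_preserving_ofLp ℂ ℂ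
  have hme := (MeasurableEquiv.toLp 2 (ℂ × ℂ)).symm.measurableEmbedding
  have h1 : Integrable fun v : WithLp 2 (ℂ × ℂ) => f (WithLp.ofLp v) :=
    hmp.integrable_comp_of_integrable (hf.integrable_of_hasCompactSupport hfs)
  have h2 : MemLp (fun v : WithLp 2 (ℂ × ℂ) => f (WithLp.ofLp v)) 2 :=
    (hf.memLp_of_hasCompactSupport hfs).comp_measurePreserving hmp
  have h := eLpNorm_fourier_eq h1 h2
  simp only [eLpNorm_eq_lintegral_rpow_enorm_toReal two_ne_zero ENNReal.ofNat_ne_top,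
    ENNReal.toReal_ofNat, ENNReal.rpow_two] at h
  have h' := ENNReal.rpow_left_injective (by norm_num : (1 / (2 : ℝ)) ≠ 0) h
  simp only [integral_mul_exp_cpair_eq_fourier]
  rw [← hmp.lintegral_comp_emb hme (fun c => ‖f c‖ₑ ^ 2), ← h',
    ← (Measure.measurePreserving_neg (volume : Measure (WithLp 2 (ℂ × ℂ)))).lintegral_comp_emb
      (MeasurableEquiv.neg _).measurableEmbedding, ← hmp.lintegral_comp_emb hme]
  simp

/-- **Young's inequality** `L¹ * L² ⊆ L²` on the real line, for `ℝ≥0∞`-valued functions. -/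
theorem lintegral_sq_lintegral_sub_mul_le {k h : ℝ → ENNReal} (hk : Measurable k)
    (hh : Measurable h) :
    ∫⁻ s, (∫⁻ t, k (s - t) * h t) ^ 2 ≤ (∫⁻ u, k u) ^ 2 * ∫⁻ t, h t ^ 2 := by
  have hks : Measurable fun z : ℝ × ℝ => k (z.1 - z.2) :=
    hk.comp (measurable_fst.sub measurable_snd)
  have hcs : ∀ s, (∫⁻ t, k (s - t) * h t) ^ 2 ≤
      (∫⁻ u, k u) * ∫⁻ t, k (s - t) * h t ^ 2 := by
    intro s
    have hm : Measurable fun t => k (s - t) := hk.comp (measurable_const.sub measurable_id)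
    have hsq : ∀ a : ENNReal, (a ^ (1 / 2 : ℝ)) ^ (2 : ℝ) = a := fun a => by
      rw [← ENNReal.rpow_mul]; norm_num
    have hsplit : ∀ a : ENNReal, a ^ (1 / 2 : ℝ) * a ^ (1 / 2 : ℝ) = a := fun a => by
      rw [← ENNReal.rpow_add_of_nonneg _ _ (by norm_num) (by norm_num)]; norm_num
    have h0 := ENNReal.lintegral_mul_le_Lp_mul_Lq (volume : Measure ℝ)
      (Real.HolderConjugate.two_two) (f := fun t => k (s - t) ^ (1 / 2 : ℝ))
      (g := fun t => k (s - t) ^ (1 / 2 : ℝ) * h t)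
      (hm.pow_const _).aemeasurable ((hm.pow_const _).mul hh).aemeasurable
    simp only [Pi.mul_apply, ← mul_assoc, hsplit, ENNReal.mul_rpow_of_nonneg _ _ zero_le_two,
      hsq] at h0
    calc (∫⁻ t, k (s - t) * h t) ^ 2
        ≤ ((∫⁻ t, k (s - t)) ^ (1 / 2 : ℝ) *
            (∫⁻ t, k (s - t) * h t ^ (2 : ℝ)) ^ (1 / 2 : ℝ)) ^ 2 := by gcongr
      _ = _ := by
        rw [mul_pow, ← ENNReal.rpow_two, ← ENNReal.rpow_two, hsq, hsq,
          lintegral_sub_left_eq_self k s]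
        simp only [ENNReal.rpow_two]
  calc ∫⁻ s, (∫⁻ t, k (s - t) * h t) ^ 2
      ≤ ∫⁻ s, (∫⁻ u, k u) * ∫⁻ t, k (s - t) * h t ^ 2 := lintegral_mono hcs
    _ = (∫⁻ u, k u) * ∫⁻ s, ∫⁻ t, k (s - t) * h t ^ 2 :=
        lintegral_const_mul _ (hks.mul ((hh.pow_const _).comp measurable_snd)).lintegral_prod_right'
    _ = (∫⁻ u, k u) * ∫⁻ t, ∫⁻ s, k (s - t) * h t ^ 2 := by
        rw [lintegral_lintegral_swap (hks.mul ((hh.pow_const _).comp measurable_snd)).aemeasurable]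
    _ = (∫⁻ u, k u) * ∫⁻ t, (∫⁻ u, k u) * h t ^ 2 := by
        congr 2 with t
        rw [lintegral_mul_const _ (f := fun s => k (s - t))
          (hk.comp (measurable_id.sub measurable_const)),
          lintegral_sub_right_eq_self k t]
    _ = _ := by rw [lintegral_const_mul _ (hh.pow_const _), sq, mul_assoc]

theorem enorm_exp_two_pi_mul_I (x : ℝ) :
    ‖Complex.exp (((2 * Real.pi : ℝ) : ℂ) * Complex.I * (x : ℂ))‖ₑ = 1 := by
  rw [mul_right_comm, ← Complex.ofReal_mul, ← ofReal_norm, Complex.norm_exp_ofReal_mul_I,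
    ENNReal.ofReal_one]

theorem enorm_pft2_le (F : ℝ × ℂ × ℂ → ℂ) (u : ℝ) (ℓ : ℂ × ℂ) :
    ‖pft2 F u ℓ‖ₑ ≤ ∫⁻ c : ℂ × ℂ, ‖F (u, c)‖ₑ := by
  refine (enorm_integral_le_lintegral_enorm _).trans (lintegral_mono fun c => ?_)
  rw [enorm_mul, enorm_exp_two_pi_mul_I, mul_one]

theorem enorm_sq_Lp_two {X : Type*} [MeasurableSpace X] {μ : Measure X} (f : Lp ℂ 2 μ) :
    ‖f‖ₑ ^ 2 = ∫⁻ x, ‖f x‖ₑ ^ 2 ∂μ := by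
  rw [Lp.enorm_def, eLpNorm_eq_lintegral_rpow_enorm_toReal two_ne_zero ENNReal.ofNat_ne_top]
  simp only [ENNReal.toReal_ofNat, ENNReal.rpow_two]
  rw [← ENNReal.rpow_two, ← ENNReal.rpow_mul]
  norm_num

/-- The operators `π̃^p_ℓ(F)` are bounded by the `L¹` norm of `F`. -/
theorem norm_le_integral_norm_of_kernel (θ p : ℝ) {F : ℝ × ℂ × ℂ → ℂ} (hF : Continuous F)
    (hFs : HasCompactSupport F) (ℓ : ℂ × ℂ)
    (T : Lp ℂ 2 (volume : Measure ℝ) →L[ℂ] Lp ℂ 2 (volume : Measure ℝ))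
    (hT : ∀ ξ : Lp ℂ 2 (volume : Measure ℝ), (T ξ : ℝ → ℂ) =ᵐ[volume]
        fun s : ℝ => ∫ t : ℝ, pft2 F (s - t) (dact θ p t ℓ) * ξ t) :
    ‖T‖ ≤ ∫ y, ‖F y‖ := by
  refine T.opNorm_le_bound (by positivity) fun ξ => ?_
  have hFm : Measurable fun y => ‖F y‖ₑ := hF.enorm.measurable
  have hFi : ∫⁻ u, ∫⁻ c : ℂ × ℂ, ‖F (u, c)‖ₑ = ENNReal.ofReal (∫ y, ‖F y‖) := by
    rw [ofReal_integral_norm_eq_lintegral_enorm (hF.integrable_of_hasCompactSupport hFs),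
      Measure.volume_eq_prod ℝ (ℂ × ℂ), lintegral_prod _ hFm.aemeasurable]
  have h2 : ‖T ξ‖ₑ ^ 2 ≤ (ENNReal.ofReal (∫ y, ‖F y‖) * ‖ξ‖ₑ) ^ 2 := by
    rw [mul_pow, enorm_sq_Lp_two, enorm_sq_Lp_two, ← hFi]
    refine le_trans ?_ (lintegral_sq_lintegral_sub_mul_le hFm.lintegral_prod_right'
      (Lp.stronglyMeasurable ξ).enorm)
    refine lintegral_mono_ae ?_
    filter_upwards [hT ξ] with s hs
    rw [hs]
    gcongr
    refine (enorm_integral_le_lintegral_enorm _).trans (lintegral_mono fun t => ?_)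
    rw [enorm_mul]
    gcongr
    exact enorm_pft2_le _ _ _
  have h3 := (ENNReal.pow_le_pow_left_iff two_ne_zero).1 h2
  rw [← ofReal_norm, ← ofReal_norm, ← ENNReal.ofReal_mul (by positivity)] at h3
  exact (ENNReal.ofReal_le_ofReal_iff (by positivity)).1 h3

/-- The action `c ↦ (e^{(p+i)t} c₁, e^{(-p+iθ)t} c₂)` of `ℝ` on `ℂ²` by which `M_p` is a semidirect
product. -/
def vact (θ p t : ℝ) (c : ℂ × ℂ) : ℂ × ℂ :=
  (Complex.exp (((p : ℂ) + Complex.I) * (t : ℂ)) * c.1,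
   Complex.exp ((-(p : ℂ) + Complex.I * (θ : ℂ)) * (t : ℂ)) * c.2)

theorem vmul_eq (θ p : ℝ) (x y : ℝ × ℂ × ℂ) :
    vmul θ p x y = (x.1 + y.1, vact θ p y.1 x.2 + y.2) := rfl

theorem vmul_vinv_eq (θ p : ℝ) (x y : ℝ × ℂ × ℂ) :
    vmul θ p (vinv θ p y) x = (x.1 - y.1, x.2 - vact θ p (x.1 - y.1) y.2) := by
  ext1
  · simp [vmul, vinv, sub_eq_neg_add]
  · simp only [vmul, vinv, vact]
    ext1
    all_goals
      simp only [mul_neg, ← mul_assoc, ← Complex.exp_add, sub_eq_neg_add]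
      congr 5
      push_cast
      ring

theorem vmul_vmul_vinv_cancel (θ p : ℝ) (x y : ℝ × ℂ × ℂ) :
    vmul θ p y (vmul θ p (vinv θ p y) x) = x := by
  rw [vmul_vinv_eq, vmul_eq]
  simp

theorem continuous_vact (θ p : ℝ) : Continuous fun z : ℝ × ℂ × ℂ => vact θ p z.1 z.2 := by
  unfold vact
  fun_prop

theorem continuous_vmul (θ p : ℝ) :
    Continuous fun z : (ℝ × ℂ × ℂ) × (ℝ × ℂ × ℂ) => vmul θ p z.1 z.2 := by
  unfold vmul
  fun_prop

theorem continuous_vinv (θ p : ℝ) : Continuous (vinv θ p) := by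
  unfold vinv
  fun_prop

theorem cpair_vact (θ p t : ℝ) (c ℓ : ℂ × ℂ) :
    cpair (vact θ p t c) ℓ = cpair c (dact θ p t ℓ) := by
  simp only [cpair, vact, dact, map_mul, ← Complex.exp_conj, map_sub, map_neg,
    Complex.conj_I, Complex.conj_ofReal, sub_neg_eq_add]
  congr 2
  · ring
  · rw [neg_mul, sub_neg_eq_add]
    ring

theorem cpair_add (c c' ℓ : ℂ × ℂ) : cpair (c + c') ℓ = cpair c ℓ + cpair c' ℓ := by
  simp [cpair, add_mul]
  ring

theorem continuous_cpair : Continuous fun z : (ℂ × ℂ) × (ℂ × ℂ) => cpair z.1 z.2 := by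
  unfold cpair
  fun_prop

/-- The left regular representation of `M_p`, applied to a function. -/
def leftReg (θ p : ℝ) (F ξ : ℝ × ℂ × ℂ → ℂ) (x : ℝ × ℂ × ℂ) : ℂ :=
  ∫ y : ℝ × ℂ × ℂ, F y * ξ (vmul θ p (vinv θ p y) x)

section

variable {F ξ : ℝ × ℂ × ℂ → ℂ}

theorem continuous_leftReg (θ p : ℝ) (hF : Continuous F) (hFs : HasCompactSupport F)
    (hξ : Continuous ξ) : Continuous (leftReg θ p F ξ) := by
  rw [← continuousOn_univ]
  refine continuousOn_integral_of_compact_support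
    (f := fun x y => F y * ξ (vmul θ p (vinv θ p y) x)) hFs ?_ fun x y _ hy => ?_
  · refine Continuous.continuousOn ((hF.comp continuous_snd).mul (hξ.comp ?_))
    exact (continuous_vmul θ p).comp
      (((continuous_vinv θ p).comp continuous_snd).prodMk continuous_fst)
  · simp [image_eq_zero_of_notMem_tsupport hy]

theorem hasCompactSupport_leftReg (θ p : ℝ) (hFs : HasCompactSupport F)
    (hξs : HasCompactSupport ξ) : HasCompactSupport (leftReg θ p F ξ) := by
  refine HasCompactSupport.intro
    ((IsCompact.prod hFs hξs).image (continuous_vmul θ p)) fun x hx => ?_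
  refine (integral_congr_ae (.of_forall fun y => ?_)).trans (integral_zero _ _)
  by_contra h
  refine hx ⟨(y, vmul θ p (vinv θ p y) x), ⟨subset_tsupport _ (left_ne_zero_of_mul h),
    subset_tsupport _ (right_ne_zero_of_mul h)⟩, vmul_vmul_vinv_cancel θ p x y⟩

theorem pft2_eq_zero_of_notMem {u : ℝ} (hu : u ∉ Prod.fst '' tsupport ξ) (ℓ : ℂ × ℂ) :
    pft2 ξ u ℓ = 0 := by
  have h : ∀ c, ξ (u, c) = 0 := fun c =>
    image_eq_zero_of_notMem_tsupport fun hc => hu ⟨_, hc, rfl⟩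
  simp [pft2, h]

theorem continuous_pft2 (hξ : Continuous ξ) (hξs : HasCompactSupport ξ) :
    Continuous fun z : ℝ × ℂ × ℂ => pft2 ξ z.1 z.2 := by
  rw [← continuousOn_univ]
  refine continuousOn_integral_of_compact_support
    (f := fun (z : ℝ × ℂ × ℂ) c => ξ (z.1, c) * Complex.exp
      (((2 * Real.pi : ℝ) : ℂ) * Complex.I * ((cpair c z.2 : ℝ) : ℂ)))
    (hξs.image continuous_snd) (Continuous.continuousOn ?_) fun z c _ hc => ?_
  · have := continuous_cpair
    have h : Continuous fun w : (ℝ × ℂ × ℂ) × ℂ × ℂ => cpair w.2 w.1.2 :=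
      this.comp (continuous_snd.prodMk (continuous_snd.comp continuous_fst))
    simp only [Function.uncurry_def]
    fun_prop
  · rw [image_eq_zero_of_notMem_tsupport fun h => hc ⟨_, h, rfl⟩, zero_mul]

theorem hasCompactSupport_slice (hξs : HasCompactSupport ξ) (s : ℝ) :
    HasCompactSupport fun c : ℂ × ℂ => ξ (s, c) :=
  HasCompactSupport.intro (hξs.image continuous_snd) fun _ hc =>
    image_eq_zero_of_notMem_tsupport fun h => hc ⟨_, h, rfl⟩

theorem memLp_pft2 (hξ : Continuous ξ) (hξs : HasCompactSupport ξ) (ℓ : ℂ × ℂ) :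
    MemLp (fun t => pft2 ξ t ℓ) 2 :=
  ((continuous_pft2 hξ hξs).comp (continuous_id.prodMk continuous_const)).memLp_of_hasCompactSupport
    (HasCompactSupport.intro (hξs.image continuous_fst) fun _ ht => pft2_eq_zero_of_notMem ht ℓ)

/-- Plancherel's theorem for the partial Fourier transform. -/
theorem lintegral_enorm_sq_pft2 (hξ : Continuous ξ) (hξs : HasCompactSupport ξ) :
    ∫⁻ ℓ : ℂ × ℂ, ∫⁻ t : ℝ, ‖pft2 ξ t ℓ‖ₑ ^ 2 = ∫⁻ x, ‖ξ x‖ₑ ^ 2 := by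
  rw [lintegral_lintegral_swap, Measure.volume_eq_prod ℝ (ℂ × ℂ), lintegral_prod]
  · refine lintegral_congr fun t => ?_
    exact lintegral_enorm_sq_integral_mul_exp_cpair (hξ.comp (by fun_prop))
      (hasCompactSupport_slice hξs t)
  · exact (hξ.enorm.measurable.pow_const 2).aemeasurable
  · exact (((continuous_pft2 hξ hξs).comp continuous_swap).enorm.measurable.pow_const 2).aemeasurable

/-- The partial Fourier transform intertwines the left regular representation with the integral
operators `π̃^p_ℓ`. -/
theorem pft2_leftReg (θ p : ℝ) (hF : Continuous F) (hFs : HasCompactSupport F)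
    (hξ : Continuous ξ) (hξs : HasCompactSupport ξ) (s : ℝ) (ℓ : ℂ × ℂ) :
    pft2 (leftReg θ p F ξ) s ℓ =
      ∫ t : ℝ, pft2 F (s - t) (dact θ p t ℓ) * pft2 ξ t ℓ := by
  set e : ℂ × ℂ → ℂ := fun c =>
    Complex.exp (((2 * Real.pi : ℝ) : ℂ) * Complex.I * ((cpair c ℓ : ℝ) : ℂ)) with he
  have he_cont : Continuous e := by
    have h : Continuous fun c => cpair c ℓ :=
      continuous_cpair.comp (continuous_id.prodMk continuous_const)
    fun_prop
  have he_add : ∀ c c', e (c + c') = e c * e c' := fun c c' => by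
    simp only [he]
    rw [cpair_add, ← Complex.exp_add, Complex.ofReal_add, mul_add]
  set H : ℂ × ℂ → ℝ × ℂ × ℂ → ℂ := fun d y =>
    F y * ξ (vmul θ p (vinv θ p y) (s, d)) * e d with hH
  have hHc : Continuous (Function.uncurry H) := by
    refine ((hF.comp continuous_snd).mul (hξ.comp ?_)).mul (he_cont.comp continuous_fst)
    exact (continuous_vmul θ p).comp (((continuous_vinv θ p).comp continuous_snd).prodMk
      (continuous_const.prodMk continuous_fst))
  have hHs : HasCompactSupport (Function.uncurry H) := by
    have hK : IsCompact ((fun z : (ℝ × ℂ × ℂ) × (ℝ × ℂ × ℂ) => ((vmul θ p z.1 z.2).2, z.1)) ''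
        (tsupport F ×ˢ tsupport ξ)) :=
      (IsCompact.prod hFs hξs).image ((continuous_vmul θ p).snd.prodMk continuous_fst)
    refine HasCompactSupport.intro hK fun z hz => ?_
    by_contra h
    have h' := left_ne_zero_of_mul h
    refine hz ⟨(z.2, vmul θ p (vinv θ p z.2) (s, z.1)),
      ⟨subset_tsupport _ (left_ne_zero_of_mul h'), subset_tsupport _ (right_ne_zero_of_mul h')⟩, ?_⟩
    simp only [vmul_vmul_vinv_cancel]
  have hHi : Integrable (Function.uncurry H)
      ((volume : Measure (ℂ × ℂ)).prod (volume : Measure (ℝ × ℂ × ℂ))) :=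
    hHc.integrable_of_hasCompactSupport hHs
  have hinner : ∀ y : ℝ × ℂ × ℂ, ∫ d, H d y =
      F y * e (vact θ p (s - y.1) y.2) * pft2 ξ (s - y.1) ℓ := fun y => by
    calc ∫ d, H d y = ∫ d, F y * (ξ (s - y.1, d - vact θ p (s - y.1) y.2) *
          e (d - vact θ p (s - y.1) y.2 + vact θ p (s - y.1) y.2)) := by
          simp only [hH, vmul_vinv_eq, mul_assoc, sub_add_cancel]
      _ = ∫ d, F y * (ξ (s - y.1, d) * e (d + vact θ p (s - y.1) y.2)) :=
          have : (volume : Measure (ℂ × ℂ)).IsAddHaarMeasure :=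
            Measure.prod.instIsAddHaarMeasure _ _
          integral_sub_right_eq_self (μ := (volume : Measure (ℂ × ℂ)))
            (fun d => F y * (ξ (s - y.1, d) * e (d + vact θ p (s - y.1) y.2))) _
      _ = ∫ d, F y * e (vact θ p (s - y.1) y.2) * (ξ (s - y.1, d) * e d) := by
          refine integral_congr_ae (.of_forall fun d => ?_)
          simp only [he_add]
          ring
      _ = _ := by rw [integral_const_mul]; rfl
  have hi2 := hHi.integral_prod_right
  simp only [Function.uncurry_apply_pair, hinner] at hi2
  calc pft2 (leftReg θ p F ξ) s ℓ = ∫ d, ∫ y, H d y := by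
        refine integral_congr_ae (.of_forall fun d => ?_)
        simp only [hH]
        rw [integral_mul_const]
        rfl
    _ = ∫ y, ∫ d, H d y := integral_integral_swap hHi
    _ = ∫ r : ℝ, ∫ c : ℂ × ℂ, F (r, c) * e (vact θ p (s - r) c) * pft2 ξ (s - r) ℓ := by
        simp only [hinner]
        exact integral_prod _ hi2
    _ = ∫ r : ℝ, pft2 F r (dact θ p (s - r) ℓ) * pft2 ξ (s - r) ℓ := by
        refine integral_congr_ae (.of_forall fun r => ?_)
        simp only [he]
        rw [integral_mul_const]
        simp only [cpair_vact]
        rfl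
    _ = _ := by
        rw [← integral_sub_left_eq_self
          (fun r => pft2 F r (dact θ p (s - r) ℓ) * pft2 ξ (s - r) ℓ) volume s]
        simp only [sub_sub_cancel]

end

theorem quasiMeasurePreserving_vact (θ p t : ℝ) :
    Measure.QuasiMeasurePreserving (vact θ p t) := by
  have : (volume : Measure (ℂ × ℂ)).IsAddHaarMeasure := Measure.prod.instIsAddHaarMeasure _ _
  let f : (ℂ × ℂ) →ₗ[ℝ] ℂ × ℂ :=
    { toFun := vact θ p t
      map_add' := fun x y => by simp [vact, mul_add]
      map_smul' := fun r x => by simp [vact, mul_left_comm] }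
  have hf : Function.Injective f := fun x y h => by
    have h1 : vact θ p t x = vact θ p t y := h
    simp only [vact, Prod.mk.injEq, mul_right_inj' (Complex.exp_ne_zero _)] at h1
    exact Prod.ext h1.1 h1.2
  exact Measure.LinearMap.quasiMeasurePreserving volume f
    (LinearEquiv.ofInjectiveEndo f hf).isUnit_det'.ne_zero

theorem leftReg_congr_ae (θ p : ℝ) (F : ℝ × ℂ × ℂ → ℂ) {ξ η : ℝ × ℂ × ℂ → ℂ}
    (hξ : Measurable ξ) (hη : Measurable η) (h : ξ =ᵐ[volume] η) :
    leftReg θ p F ξ = leftReg θ p F η := by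
  have : (volume : Measure (ℂ × ℂ)).IsAddHaarMeasure := Measure.prod.instIsAddHaarMeasure _ _
  funext x
  have hv : Measurable fun y => vmul θ p (vinv θ p y) x :=
    ((continuous_vmul θ p).comp ((continuous_vinv θ p).prodMk continuous_const)).measurable
  have h1 : ∀ᵐ t : ℝ, ∀ᵐ d : ℂ × ℂ, ξ (t, d) = η (t, d) := Measure.ae_ae_of_ae_prod h
  have h2 : ∀ᵐ r : ℝ, ∀ᵐ c : ℂ × ℂ,
      ξ (vmul θ p (vinv θ p (r, c)) x) = η (vmul θ p (vinv θ p (r, c)) x) := by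
    filter_upwards [(Measure.measurePreserving_sub_left volume x.1).quasiMeasurePreserving.ae h1]
      with r hr
    simp only [vmul_vinv_eq]
    exact (((Measure.measurePreserving_sub_left volume x.2).quasiMeasurePreserving).comp
      (quasiMeasurePreserving_vact θ p (x.1 - r))).ae hr
  have h3 : ∀ᵐ y : ℝ × ℂ × ℂ, ξ (vmul θ p (vinv θ p y) x) = η (vmul θ p (vinv θ p y) x) :=
    (Measure.ae_prod_iff_ae_ae (measurableSet_eq_fun (hξ.comp hv) (hη.comp hv))).2 h2
  refine integral_congr_ae ?_
  filter_upwards [h3] with y hy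
  rw [hy]

theorem lintegral_enorm_sq_leftReg_le (θ p : ℝ) {F ξ : ℝ × ℂ × ℂ → ℂ} (hF : Continuous F)
    (hFs : HasCompactSupport F) (hξ : Continuous ξ) (hξs : HasCompactSupport ξ)
    (π : ℂ × ℂ → (Lp ℂ 2 (volume : Measure ℝ) →L[ℂ] Lp ℂ 2 (volume : Measure ℝ)))
    (hπ : ∀ (ℓ : ℂ × ℂ) (g : Lp ℂ 2 (volume : Measure ℝ)), (π ℓ g : ℝ → ℂ) =ᵐ[volume]
        fun s : ℝ => ∫ t : ℝ, pft2 F (s - t) (dact θ p t ℓ) * g t)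
    {C : ENNReal} (hC : ∀ ℓ, ‖π ℓ‖ₑ ≤ C) :
    ∫⁻ x, ‖leftReg θ p F ξ x‖ₑ ^ 2 ≤ C ^ 2 * ∫⁻ x, ‖ξ x‖ₑ ^ 2 := by
  have hslice : ∀ ℓ, ∫⁻ t, ‖pft2 (leftReg θ p F ξ) t ℓ‖ₑ ^ 2 ≤
      C ^ 2 * ∫⁻ t, ‖pft2 ξ t ℓ‖ₑ ^ 2 := fun ℓ => by
    set g : Lp ℂ 2 (volume : Measure ℝ) := (memLp_pft2 hξ hξs ℓ).toLp
    have hg : ⇑g =ᵐ[volume] fun t => pft2 ξ t ℓ := (memLp_pft2 hξ hξs ℓ).coeFn_toLp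
    have h1 : ∫⁻ t, ‖pft2 (leftReg θ p F ξ) t ℓ‖ₑ ^ 2 = ‖π ℓ g‖ₑ ^ 2 := by
      rw [enorm_sq_Lp_two]
      refine lintegral_congr_ae ?_
      filter_upwards [hπ ℓ g] with s hs
      rw [hs, pft2_leftReg θ p hF hFs hξ hξs]
      congr 2
      refine integral_congr_ae ?_
      filter_upwards [hg] with t ht
      rw [ht]
    have h2 : ∫⁻ t, ‖pft2 ξ t ℓ‖ₑ ^ 2 = ‖g‖ₑ ^ 2 := by
      rw [enorm_sq_Lp_two]
      refine lintegral_congr_ae ?_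
      filter_upwards [hg] with t ht
      rw [ht]
    rw [h1, h2, ← mul_pow]
    gcongr
    exact ((π ℓ).le_opENorm g).trans (by gcongr; exact hC ℓ)
  rw [← lintegral_enorm_sq_pft2 (continuous_leftReg θ p hF hFs hξ)
    (hasCompactSupport_leftReg θ p hFs hξs), ← lintegral_enorm_sq_pft2 hξ hξs]
  refine (lintegral_mono hslice).trans (lintegral_const_mul _ ?_).le
  exact (((continuous_pft2 hξ hξs).comp continuous_swap).enorm.measurable.pow_const
    2).lintegral_prod_right'

/-- The norm of the left regular representation `Λ^p(F)` on `L²(M)` is bounded by the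
supremum over `ℓ ∈ ℂ²` of the norms of the integral operators `π̃^p_ℓ(F)` with kernels
`(s,t) ↦ F̂(s−t, t ⊙_p ℓ)`. -/
theorem stmt12 (θ p : ℝ) (hp : p ∈ Set.Icc (-1 : ℝ) 1)
    (F : ℝ × ℂ × ℂ → ℂ) (hF : Continuous F) (hFs : HasCompactSupport F)
    (Λ : Lp ℂ 2 (volume : Measure (ℝ × ℂ × ℂ)) →L[ℂ]
      Lp ℂ 2 (volume : Measure (ℝ × ℂ × ℂ)))
    (hΛ : ∀ ξ : Lp ℂ 2 (volume : Measure (ℝ × ℂ × ℂ)),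
      (Λ ξ : ℝ × ℂ × ℂ → ℂ) =ᵐ[volume]
        fun x : ℝ × ℂ × ℂ => ∫ y : ℝ × ℂ × ℂ, F y * ξ (vmul θ p (vinv θ p y) x))
    (π : ℂ × ℂ → (Lp ℂ 2 (volume : Measure ℝ) →L[ℂ] Lp ℂ 2 (volume : Measure ℝ)))
    (hπ : ∀ (ℓ : ℂ × ℂ) (ξ : Lp ℂ 2 (volume : Measure ℝ)),
      (π ℓ ξ : ℝ → ℂ) =ᵐ[volume]
        fun s : ℝ => ∫ t : ℝ, pft2 F (s - t) (dact θ p t ℓ) * ξ t) :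
    ‖Λ‖ ≤ ⨆ ℓ : ℂ × ℂ, ‖π ℓ‖ := by
  have hbdd : BddAbove (Set.range fun ℓ => ‖π ℓ‖) := ⟨∫ y, ‖F y‖, by
    rintro _ ⟨ℓ, rfl⟩
    exact norm_le_integral_norm_of_kernel θ p hF hFs ℓ (π ℓ) (hπ ℓ)⟩
  set C : ℝ := ⨆ ℓ : ℂ × ℂ, ‖π ℓ‖ with hCdef
  have hC0 : 0 ≤ C := Real.iSup_nonneg fun ℓ => norm_nonneg _
  have hC : ∀ ℓ, ‖π ℓ‖ₑ ≤ ENNReal.ofReal C := fun ℓ => by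
    rw [← ofReal_norm]
    exact ENNReal.ofReal_le_ofReal (le_ciSup hbdd ℓ)
  refine Λ.opNorm_le_bound hC0 fun ξ => ?_
  have hclosed : IsClosed {ξ : Lp ℂ 2 (volume : Measure (ℝ × ℂ × ℂ)) | ‖Λ ξ‖ ≤ C * ‖ξ‖} :=
    isClosed_le (by fun_prop) (by fun_prop)
  refine hclosed.closure_subset (EMetric.mem_closure_iff.2 fun ε hε => ?_)
  obtain ⟨δ, hδ, hδε⟩ := exists_between hε
  obtain ⟨η, hηs, hηξ, hη, hηm⟩ :=
    (Lp.memLp ξ).exists_hasCompactSupport_eLpNorm_sub_le ENNReal.ofNat_ne_top hδ.ne'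
  refine ⟨hηm.toLp η, ?_, ?_⟩
  · have h1 : ‖Λ (hηm.toLp η)‖ₑ ^ 2 ≤ (ENNReal.ofReal C * ‖hηm.toLp η‖ₑ) ^ 2 := by
      rw [mul_pow, enorm_sq_Lp_two, enorm_sq_Lp_two]
      have h2 := lintegral_enorm_sq_leftReg_le θ p hF hFs hη hηs π hπ hC
      have h3 : ⇑(Λ (hηm.toLp η)) =ᵐ[volume] leftReg θ p F η := by
        rw [← leftReg_congr_ae θ p F (Lp.stronglyMeasurable (hηm.toLp η)).measurable
          hη.measurable hηm.coeFn_toLp]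
        exact hΛ _
      convert h2 using 1
      · refine lintegral_congr_ae ?_
        filter_upwards [h3] with x hx
        rw [hx]
      · congr 1
        refine lintegral_congr_ae ?_
        filter_upwards [hηm.coeFn_toLp] with x hx
        rw [hx]
    have h4 := (ENNReal.pow_le_pow_left_iff two_ne_zero).1 h1
    rw [← ofReal_norm, ← ofReal_norm, ← ENNReal.ofReal_mul hC0] at h4
    exact (ENNReal.ofReal_le_ofReal_iff (by positivity)).1 h4
  · refine lt_of_le_of_lt ?_ hδε
    rw [Lp.edist_def, eLpNorm_congr_ae ((Filter.EventuallyEq.refl _ _).sub hηm.coeFn_toLp)]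
    exact hηξ

end
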